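/- Lowering relation in the first variable index x₁: for every real q with 0 < q < 1, every positive integer N, all nonzero real numbers θ, φ, all integers n₁, n₂ ≥ 0 with n₁+n₂ ≤ N, and all integers x₁ ≥ 1, x₂ ≥ 0 with x₁+x₂ ≤ N, one has (q(1-q^{-x₁})/θ²) K_{n₁,n₂}(x₁-1,x₂; θ,φ; N) = q^{-2n₁} K_{n₁+1,n₂}(x₁,x₂; θ,φ; N+1) + φ² q^{-n₁-2n₂-1} K_{n₁,n₂+1}(x₁,x₂; θ,φ; N+1) - φ² q^{-N-2}(1-q^{N-n₁-n₂+1}) K_{n₁,n₂}(x₁,x₂; θ,φ; N+1). -/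

import Mathlib

open Finset

/-- The q-Pochhammer symbol `(a;q)_n = ∏_{k=0}^{n-1} (1 - a q^k)`. -/
noncomputable def qPoch (q a : ℝ) (n : ℕ) : ℝ := ∏ k ∈ Finset.range n, (1 - a * q ^ k)

/-- The quantum q-Krawtchouk polynomial `k_n(x;p,N;q)`, defined for all integers `x, N`. -/
noncomputable def qKraw (q : ℝ) (n : ℕ) (x N : ℤ) (p : ℝ) : ℝ :=
  (-1 : ℝ) ^ n * q ^ (n * (n - 1) / 2) *
    ∑ k ∈ Finset.range (n + 1),
      qPoch q (q ^ (-(n : ℤ))) k * qPoch q (q ^ (-x)) k *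
        qPoch q (q ^ ((k : ℤ) - N)) (n - k) / qPoch q q k * (p * q ^ (n + 1)) ^ k

/-- The bivariate quantum q-Krawtchouk polynomial of Gasper and Rahman,
`K_{n₁,n₂}(x₁,x₂;θ,φ;N) = k_{n₁}(x₁;θ^{-2},x₁+x₂;q) k_{n₂}(x₁+x₂-n₁;φ^{-2},N-n₁;q)`,
with the convention that it vanishes when a degree index is negative. -/
noncomputable def Kq (q : ℝ) (n₁ n₂ x₁ x₂ : ℤ) (θ φ : ℝ) (N : ℤ) : ℝ :=
  if 0 ≤ n₁ ∧ 0 ≤ n₂ then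
    qKraw q n₁.toNat x₁ (x₁ + x₂) (θ ^ 2)⁻¹ *
      qKraw q n₂.toNat (x₁ + x₂ - n₁) (N - n₁) (φ ^ 2)⁻¹
  else 0

/-- The q-trinomial coefficient `[N; x₁, x₂]_q`. -/
noncomputable def qTrinom (q : ℝ) (N x₁ x₂ : ℕ) : ℝ :=
  qPoch q q N / (qPoch q q x₁ * qPoch q q x₂ * qPoch q q (N - x₁ - x₂))

/-- The orthogonality weight `Δ^{(N)}_{x₁,x₂}(θ,φ)`. -/
noncomputable def Δw (q : ℝ) (N x₁ x₂ : ℕ) (θ φ : ℝ) : ℝ :=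
  (-1 : ℝ) ^ (N - x₁) * (θ ^ 2 * q⁻¹) ^ (x₁ + x₂) * q ^ (x₁ * (x₁ - 1) / 2) *
    qTrinom q N x₁ x₂ * qPoch q ((θ ^ 2)⁻¹ * q) x₂ * qPoch q ((φ ^ 2)⁻¹ * q) (N - x₁ - x₂) *
    φ ^ (2 * N) * q ^ (-((N : ℤ) * (N + 1) / 2))

/-- The normalization constant `H^{(N)}_{n₁,n₂}(θ,φ)`. -/
noncomputable def Hn (q : ℝ) (N n₁ n₂ : ℕ) (θ φ : ℝ) : ℝ :=
  (-1 : ℝ) ^ (n₁ + n₂) * qPoch q (q * (θ ^ 2)⁻¹) n₁ * qPoch q (q * (φ ^ 2)⁻¹) n₂ *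
    φ ^ (2 * n₁) * (qPoch q q N / qPoch q q (N - n₁ - n₂)) ^ 2 * (qTrinom q N n₁ n₂)⁻¹ *
    q ^ (3 * ((n₁ : ℤ) * (n₁ - 1)) / 2 + 3 * ((n₂ : ℤ) * (n₂ - 1)) / 2 +
          (n₁ : ℤ) * n₂ - (N : ℤ) * (n₁ + n₂) - 2 * n₁ - n₂)

/-- The dual weight `Δ̃^{(N)}_{n₁,n₂}(θ,φ)`. -/
noncomputable def Δdual (q : ℝ) (N n₁ n₂ : ℕ) (θ φ : ℝ) : ℝ :=
  (-1 : ℝ) ^ (n₁ + n₂) * q ^ (-((n₁ : ℤ) * (n₁ - 1)) - (n₂ : ℤ) * (n₂ - 1)) *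
    φ ^ (-(2 * (n₁ : ℤ))) * (qPoch q q (N - n₁ - n₂) / qPoch q q N) ^ 2 * qTrinom q N n₁ n₂ *
    q ^ ((N : ℤ) * (n₁ + n₂) + 2 * n₁ + n₂ - (n₁ : ℤ) * n₂ -
          (n₁ : ℤ) * (n₁ - 1) / 2 - (n₂ : ℤ) * (n₂ - 1) / 2) /
    (qPoch q (q * (θ ^ 2)⁻¹) n₁ * qPoch q (q * (φ ^ 2)⁻¹) n₂)

theorem qPoch_succ (q a : ℝ) (n : ℕ) : qPoch q a (n + 1) = qPoch q a n * (1 - a * q ^ n) :=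
  prod_range_succ _ _

theorem qPoch_succ' (q a : ℝ) (n : ℕ) : qPoch q a (n + 1) = (1 - a) * qPoch q (a * q) n := by
  simp only [qPoch, prod_range_succ', pow_succ', mul_assoc, pow_zero, mul_one]
  exact mul_comm _ _

theorem qPoch_self_ne_zero {q : ℝ} (hq0 : 0 < q) (hq1 : q < 1) (n : ℕ) : qPoch q q n ≠ 0 := by
  refine prod_ne_zero_iff.mpr fun k _ => ?_
  rw [← pow_succ']
  exact ne_of_gt (sub_pos.mpr (pow_lt_one₀ hq0.le hq1 k.succ_ne_zero))

/-- The coefficient of `(q^{-x};q)_{k+1}` in the lowering relation for `qKraw`. -/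
theorem qKraw_lowering_coeff {q : ℝ} (hq0 : 0 < q) (hq1 : q < 1) (n k : ℕ) (hk : k ≤ n)
    (x N : ℤ) (p : ℝ) :
    q * (1 - q ^ (-x)) * p *
      (qPoch q (q ^ (-(n : ℤ))) k * qPoch q (q ^ (-(x - 1))) k *
        qPoch q (q ^ ((k : ℤ) - (N - 1))) (n - k) / qPoch q q k * (p * q ^ (n + 1)) ^ k) =
    -q ^ (-(n : ℤ)) *
      (qPoch q (q ^ (-((n + 1 : ℕ) : ℤ))) (k + 1) * qPoch q (q ^ (-x)) (k + 1) *
        qPoch q (q ^ (((k + 1 : ℕ) : ℤ) - N)) (n + 1 - (k + 1)) / qPoch q q (k + 1) *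
          (p * q ^ (n + 1 + 1)) ^ (k + 1)) +
    q ^ (-(n : ℤ)) * (1 - q ^ ((n : ℤ) - N)) *
      (qPoch q (q ^ (-(n : ℤ))) (k + 1) * qPoch q (q ^ (-x)) (k + 1) *
        qPoch q (q ^ (((k + 1 : ℕ) : ℤ) - N)) (n - (k + 1)) / qPoch q q (k + 1) *
          (p * q ^ (n + 1)) ^ (k + 1)) := by
  have hq : q ≠ 0 := hq0.ne'
  have hx : q ^ (-(x - 1)) = q ^ (-x) * q := by rw [← zpow_add_one₀ hq]; congr 1; ring
  have hn : q ^ (-((n + 1 : ℕ) : ℤ)) * q = q ^ (-(n : ℤ)) := by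
    rw [← zpow_add_one₀ hq]; congr 1; push_cast; ring
  have hkN : (k : ℤ) - (N - 1) = ((k + 1 : ℕ) : ℤ) - N := by push_cast; ring
  have hP := qPoch_self_ne_zero hq0 hq1 k
  have hP' := qPoch_self_ne_zero hq0 hq1 (k + 1)
  have hshift : (1 - q ^ (-(n : ℤ)) * q ^ k) *
      ((1 - q ^ ((n : ℤ) - N)) * qPoch q (q ^ (((k + 1 : ℕ) : ℤ) - N)) (n - (k + 1))) =
      (1 - q ^ (-(n : ℤ)) * q ^ k) * qPoch q (q ^ (((k + 1 : ℕ) : ℤ) - N)) (n - k) := by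
    rcases hk.eq_or_lt with rfl | hlt
    · simp [hq]
    · obtain ⟨d, rfl⟩ := Nat.exists_eq_add_of_lt hlt
      rw [show k + d + 1 - (k + 1) = d by omega, show k + d + 1 - k = d + 1 by omega, qPoch_succ,
        ← zpow_natCast q d, ← zpow_add₀ hq,
        show ((k + 1 : ℕ) : ℤ) - N + d = ((k + d + 1 : ℕ) : ℤ) - N by push_cast; ring]
      ring
  rw [qPoch_succ' q (q ^ (-((n + 1 : ℕ) : ℤ))), hn, qPoch_succ q (q ^ (-(n : ℤ))),
    qPoch_succ' q (q ^ (-x)), hx, hkN, Nat.add_sub_add_right]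
  rw [qPoch_succ] at hP' ⊢
  have hP'' := right_ne_zero_of_mul hP'
  have hU : q ^ (-(n : ℤ)) = (q ^ n)⁻¹ := by simp
  have hU' : q ^ (-((n + 1 : ℕ) : ℤ)) = (q ^ n * q)⁻¹ := by rw [zpow_neg, zpow_natCast, pow_succ]
  rw [hU] at hshift ⊢
  rw [hU']
  generalize qPoch q (q ^ (((k + 1 : ℕ) : ℤ) - N)) (n - (k + 1)) = B at *
  generalize qPoch q (q ^ (((k + 1 : ℕ) : ℤ) - N)) (n - k) = C at *
  generalize qPoch q (q ^ n)⁻¹ k = D at *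
  generalize qPoch q (q ^ (-x) * q) k = E at *
  generalize q ^ ((n : ℤ) - N) = F at *
  generalize q ^ (-x) = a at *
  generalize qPoch q q k = P at *
  have hqn : q ^ n ≠ 0 := pow_ne_zero n hq
  linear_combination (norm := skip) -((q ^ n)⁻¹ * D * ((1 - a) * E) / (P * (1 - q * q ^ k)) *
    (p * q ^ (n + 1)) ^ (k + 1)) * hshift
  field_simp
  ring

/-- The lowering relation for the univariate quantum q-Krawtchouk polynomials. -/
theorem qKraw_lowering {q : ℝ} (hq0 : 0 < q) (hq1 : q < 1) (n : ℕ) (x N : ℤ) (p : ℝ) :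
    q * (1 - q ^ (-x)) * p * qKraw q n (x - 1) (N - 1) p =
      q ^ (-(2 * (n : ℤ))) * qKraw q (n + 1) x N p +
        q ^ (-(n : ℤ)) * (1 - q ^ ((n : ℤ) - N)) * qKraw q n x N p := by
  have hq : q ≠ 0 := hq0.ne'
  have hvanish : qPoch q (q ^ (-(n : ℤ))) (n + 1) = 0 := by
    rw [qPoch_succ]; simp [hq]
  have hsum := sum_congr (rfl : range (n + 1) = range (n + 1)) fun k hk =>
    qKraw_lowering_coeff hq0 hq1 n k (Nat.lt_succ_iff.mp (mem_range.mp hk)) x N p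
  have hzero : q ^ (-(n : ℤ)) * (1 - q ^ ((n : ℤ) - N)) * qPoch q (q ^ (-N)) n =
      q ^ (-(n : ℤ)) * qPoch q (q ^ (-N)) (n + 1) := by
    rw [qPoch_succ, ← zpow_natCast q n, ← zpow_add₀ hq, show -N + (n : ℤ) = n - N by ring]
    ring
  rw [sum_add_distrib, ← mul_sum, ← mul_sum, ← mul_sum] at hsum
  have hext : ∀ f : ℕ → ℝ, f (n + 1) = 0 →
      ∑ k ∈ range (n + 1), f k = ∑ k ∈ range (n + 1), f (k + 1) + f 0 := fun f hf => by
    rw [← sum_range_succ', sum_range_succ _ (n + 1), hf, add_zero]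
  have hpow : q ^ ((n + 1) * (n + 1 - 1) / 2) = q ^ (n * (n - 1) / 2) * q ^ n := by
    rw [Nat.triangle_succ, pow_add]
  have h2 : q ^ (-(2 * (n : ℤ))) * q ^ n = q ^ (-(n : ℤ)) := by
    rw [← zpow_natCast q n, ← zpow_add₀ hq]; congr 1; ring
  unfold qKraw
  rw [hpow, sum_range_succ' _ (n + 1),
    hext (fun k => qPoch q (q ^ (-(n : ℤ))) k * qPoch q (q ^ (-x)) k *
        qPoch q (q ^ ((k : ℤ) - N)) (n - k) / qPoch q q k * (p * q ^ (n + 1)) ^ k)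
      (by simp only [hvanish, zero_mul, zero_div])]
  have hP0 : ∀ a, qPoch q a 0 = 1 := fun a => prod_range_zero _
  simp only [hP0, pow_zero, Nat.cast_zero, zero_sub, Nat.sub_zero, mul_one, one_mul, div_one]
  set S := ∑ k ∈ range (n + 1),
      qPoch q (q ^ (-((n + 1 : ℕ) : ℤ))) (k + 1) * qPoch q (q ^ (-x)) (k + 1) *
        qPoch q (q ^ (((k + 1 : ℕ) : ℤ) - N)) (n + 1 - (k + 1)) / qPoch q q (k + 1) *
          (p * q ^ (n + 1 + 1)) ^ (k + 1)
  linear_combination ((-1 : ℝ) ^ n * q ^ (n * (n - 1) / 2)) * (hsum - hzero) -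
    (-1 : ℝ) ^ (n + 1) * q ^ (n * (n - 1) / 2) * (S + qPoch q (q ^ (-N)) (n + 1)) * h2

/-- Lowering relation in the first variable index `x₁`. -/
theorem lowering_x1 (q : ℝ) (hq0 : 0 < q) (hq1 : q < 1)
    (N : ℕ) (hN : 0 < N) (θ φ : ℝ) (hθ : θ ≠ 0) (hφ : φ ≠ 0)
    (n₁ n₂ : ℕ) (hn : n₁ + n₂ ≤ N) (x₁ x₂ : ℕ) (hx₁ : 1 ≤ x₁) (hx : x₁ + x₂ ≤ N) :
    q * (1 - q ^ (-(x₁ : ℤ))) / θ ^ 2 * Kq q n₁ n₂ ((x₁ : ℤ) - 1) x₂ θ φ N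
    = q ^ (-(2 * (n₁ : ℤ))) * Kq q (n₁ + 1) n₂ x₁ x₂ θ φ ((N : ℤ) + 1)
      + φ ^ 2 * q ^ (-(n₁ : ℤ) - 2 * n₂ - 1) * Kq q n₁ (n₂ + 1) x₁ x₂ θ φ ((N : ℤ) + 1)
      - φ ^ 2 * q ^ (-(N : ℤ) - 2) * (1 - q ^ ((N : ℤ) - n₁ - n₂ + 1)) *
        Kq q n₁ n₂ x₁ x₂ θ φ ((N : ℤ) + 1) := by
  have hq : q ≠ 0 := hq0.ne'
  have h₁ := qKraw_lowering hq0 hq1 n₁ x₁ ((x₁ : ℤ) + x₂) (θ ^ 2)⁻¹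
  have h₂ := qKraw_lowering hq0 hq1 n₂ ((x₁ : ℤ) + x₂ - n₁) ((N : ℤ) + 1 - n₁) (φ ^ 2)⁻¹
  have hc₁ : (0 : ℤ) ≤ (n₁ : ℤ) + 1 := by positivity
  have hc₂ : (0 : ℤ) ≤ (n₂ : ℤ) + 1 := by positivity
  have ht : ∀ n : ℕ, ((n : ℤ) + 1).toNat = n + 1 := fun n => by omega
  simp only [Kq, Nat.cast_nonneg, hc₁, hc₂, and_self, if_true, Int.toNat_natCast, ht]
  rw [show (x₁ : ℤ) - 1 + x₂ = x₁ + x₂ - 1 by ring,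
    show (x₁ : ℤ) + x₂ - 1 - n₁ = x₁ + x₂ - n₁ - 1 by ring,
    show (x₁ : ℤ) + x₂ - (n₁ + 1) = x₁ + x₂ - n₁ - 1 by ring,
    show (N : ℤ) + 1 - (n₁ + 1) = N - n₁ by ring]
  rw [show (N : ℤ) + 1 - n₁ - 1 = N - n₁ by ring] at h₂
  have e₁ : q ^ (-(n₁ : ℤ) - 2 * n₂ - 1) = q ^ (-(n₁ : ℤ) - 1) * q ^ (-(2 * (n₂ : ℤ))) := by
    rw [← zpow_add₀ hq]; congr 1; ring
  have e₂ : q ^ (-(N : ℤ) - 2) * (1 - q ^ ((N : ℤ) - n₁ - n₂ + 1)) =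
      -(q ^ (-(n₁ : ℤ) - 1) * (q ^ (-(n₂ : ℤ)) * (1 - q ^ ((n₂ : ℤ) - (N + 1 - n₁))))) := by
    simp only [mul_sub, mul_one, ← zpow_add₀ hq]
    ring_nf
  have e₃ : q ^ (-(n₁ : ℤ)) * (1 - q ^ ((n₁ : ℤ) - (x₁ + x₂))) =
      q ^ (-(n₁ : ℤ) - 1) * (q * (1 - q ^ (-((x₁ : ℤ) + x₂ - n₁)))) := by
    rw [← mul_assoc, ← zpow_add_one₀ hq, sub_add_cancel, neg_sub]
  have hφ' : φ ^ 2 * (φ ^ 2)⁻¹ = 1 := mul_inv_cancel₀ (pow_ne_zero 2 hφ)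
  rw [e₃] at h₁
  rw [e₁, mul_assoc (φ ^ 2) (q ^ (-(N : ℤ) - 2)), e₂]
  set A := qKraw q n₁ x₁ ((x₁ : ℤ) + x₂) (θ ^ 2)⁻¹
  set B := qKraw q n₂ ((x₁ : ℤ) + x₂ - n₁ - 1) ((N : ℤ) - n₁) (φ ^ 2)⁻¹
  linear_combination B * h₁ + φ ^ 2 * q ^ (-(n₁ : ℤ) - 1) * A * h₂ -
    q ^ (-(n₁ : ℤ) - 1) * (q * (1 - q ^ (-((x₁ : ℤ) + x₂ - n₁)))) * A * B * hφ'
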